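/- Assume λ > cT(1+T). Then the value function V is C¹ on H×[0,T] and satisfies the Hamilton–Jacobi–Bellman equation ∂V/∂t(X,t) − (1/(2λ))||D_X V(X,t)||² + F(X) = 0 for all X in H and t in [0,T), with terminal condition V(X,T) = F_T(X). -/

import Mathlib

open MeasureTheory Set
open scoped RealInnerProductSpace

variable {H : Type*} [NormedAddCommGroup H] [InnerProductSpace ℝ H] [CompleteSpace H]

/-- The state `X(s) = X + ∫_t^s v(σ) dσ` associated to the control `v`. -/
noncomputable def state (X : H) (t : ℝ) (v : ℝ → H) (s : ℝ) : H :=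
  X + ∫ σ in t..s, v σ

/-- A control belongs to `L²(t,T;H)`. -/
def Admissible (t T : ℝ) (v : ℝ → H) : Prop :=
  IntervalIntegrable v volume t T ∧ IntervalIntegrable (fun s => ‖v s‖ ^ 2) volume t T

/-- The cost functional `J_{X,t}(v)`. -/
noncomputable def cost (F FT : H → ℝ) (lam : ℝ) (X : H) (t T : ℝ) (v : ℝ → H) : ℝ :=
  lam / 2 * (∫ s in t..T, ‖v s‖ ^ 2) + (∫ s in t..T, F (state X t v s)) + FT (state X t v T)

/-- The value function `V(X,t) = inf_v J_{X,t}(v)`. -/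
noncomputable def valueFn (F FT : H → ℝ) (lam T : ℝ) (X : H) (t : ℝ) : ℝ :=
  sInf ((fun v => cost F FT lam X t T v) '' {v : ℝ → H | Admissible t T v})

/-- The adjoint state `Z(s) = D F_T(Y(T)) + ∫_s^T D F(Y(σ)) dσ` associated to a path `Y`. -/
noncomputable def adjZ (DF DFT : H → H) (T : ℝ) (Y : ℝ → H) (s : ℝ) : H :=
  DFT (Y T) + ∫ σ in s..T, DF (Y σ)

/-- `Y` solves the two-point boundary value problem
`dY/ds = -(1/λ) Z(s)`, `-dZ/ds = D F(Y(s))`, `Y(t) = X`, `Z(T) = D F_T(Y(T))`,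
where `Z = adjZ DF DFT T Y` encodes the two last conditions. -/
def IsOptimalPath (DF DFT : H → H) (lam T : ℝ) (X : H) (t : ℝ) (Y : ℝ → H) : Prop :=
  ContinuousOn Y (Icc t T) ∧ Y t = X ∧
    ∀ s ∈ Icc t T, HasDerivWithinAt Y (-(1 / lam) • adjZ DF DFT T Y s) (Icc t T) s

open Filter Topology Asymptotics

/-- The first-order Taylor remainder of a function whose gradient is `c`-Lipschitz. -/
lemma abs_sub_sub_inner_le_of_lipschitz_gradient {F : H → ℝ} {DF : H → H} {c : ℝ}
    (hF : ∀ X, HasGradientAt F (DF X) X) (hDF : ∀ X₁ X₂ : H, ‖DF X₁ - DF X₂‖ ≤ c * ‖X₁ - X₂‖)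
    (a b : H) : |F b - F a - ⟪DF a, b - a⟫| ≤ c / 2 * ‖b - a‖ ^ 2 := by
  have hφ : ∀ r : ℝ, HasDerivAt (fun r : ℝ => F (a + r • (b - a)) - F a - r * ⟪DF a, b - a⟫)
      (⟪DF (a + r • (b - a)), b - a⟫ - ⟪DF a, b - a⟫) r := by
    intro r
    have h1 : HasDerivAt (fun r : ℝ => a + r • (b - a)) (b - a) r := by
      simpa using ((hasDerivAt_id r).smul_const (b - a)).const_add a
    have h2 := (hF (a + r • (b - a))).hasFDerivAt.comp_hasDerivAt r h1
    have h3 : HasDerivAt (fun r : ℝ => r * ⟪DF a, b - a⟫) ⟪DF a, b - a⟫ r := by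
      simpa using (hasDerivAt_id r).mul_const ⟪DF a, b - a⟫
    exact ((h2.sub_const (F a)).sub h3).congr_deriv (by simp)
  have hB : ∀ r : ℝ, HasDerivAt (fun r : ℝ => c / 2 * ‖b - a‖ ^ 2 * r ^ 2)
      (c * ‖b - a‖ ^ 2 * r) r := by
    intro r
    exact ((hasDerivAt_pow 2 r).const_mul (c / 2 * ‖b - a‖ ^ 2)).congr_deriv (by simp; ring)
  have key := image_norm_le_of_norm_deriv_right_le_deriv_boundary
    (fun r _ => (hφ r).continuousAt.continuousWithinAt)
    (fun r _ => (hφ r).hasDerivWithinAt) (a := 0) (b := 1) (by simp) hB ?_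
    (right_mem_Icc.2 zero_le_one)
  · simpa using key
  · intro r hr
    rw [← inner_sub_left]
    calc ‖⟪DF (a + r • (b - a)) - DF a, b - a⟫‖
        ≤ ‖DF (a + r • (b - a)) - DF a‖ * ‖b - a‖ := norm_inner_le_norm _ _
      _ ≤ c * ‖a + r • (b - a) - a‖ * ‖b - a‖ := by gcongr; exact hDF _ _
      _ = c * ‖b - a‖ ^ 2 * r := by
        rw [add_sub_cancel_left, norm_smul, Real.norm_of_nonneg hr.1]; ring

omit [CompleteSpace H] in
/-- The Cauchy-Schwarz inequality for the integral of a vector-valued function. -/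
lemma sq_norm_intervalIntegral_le {t s : ℝ} (hts : t ≤ s) {w : ℝ → H}
    (hw : IntervalIntegrable w volume t s)
    (hw2 : IntervalIntegrable (fun σ => ‖w σ‖ ^ 2) volume t s) :
    ‖∫ σ in t..s, w σ‖ ^ 2 ≤ (s - t) * ∫ σ in t..s, ‖w σ‖ ^ 2 := by
  rcases hts.eq_or_lt with rfl | hlt
  · simp
  set I := ∫ σ in t..s, ‖w σ‖ with hI
  set Q := ∫ σ in t..s, ‖w σ‖ ^ 2 with hQ
  have hnorm : ‖∫ σ in t..s, w σ‖ ≤ I := intervalIntegral.norm_integral_le_integral_norm hts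
  have hpos : 0 ≤ ∫ σ in t..s, ((s - t) * ‖w σ‖ - I) ^ 2 :=
    intervalIntegral.integral_nonneg hts fun _ _ => sq_nonneg _
  have hexp : ∫ σ in t..s, ((s - t) * ‖w σ‖ - I) ^ 2
      = (s - t) ^ 2 * Q - 2 * (s - t) * I * I + (s - t) * I ^ 2 := by
    have : ∀ σ, ((s - t) * ‖w σ‖ - I) ^ 2
        = (s - t) ^ 2 * ‖w σ‖ ^ 2 - 2 * (s - t) * I * ‖w σ‖ + I ^ 2 := fun σ => by ring
    simp_rw [this]
    rw [intervalIntegral.integral_add ((hw2.const_mul _).sub (hw.norm.const_mul _)) (by simp),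
      intervalIntegral.integral_sub (hw2.const_mul _) (hw.norm.const_mul _),
      intervalIntegral.integral_const_mul, intervalIntegral.integral_const_mul]
    simp [hI, hQ]
  rw [hexp] at hpos
  have h2 : ‖∫ σ in t..s, w σ‖ ^ 2 ≤ I ^ 2 := by gcongr
  have hst : 0 < s - t := sub_pos.2 hlt
  nlinarith

/-- Integration by parts, in the form of an exchange of the order of integration over the
triangle `t ≤ s ≤ σ ≤ T`. -/
lemma integral_inner_integral_swap {t T : ℝ} (htT : t ≤ T) {g w : ℝ → H} (hg : Continuous g)
    (hw : IntervalIntegrable w volume t T) :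
    ∫ s in t..T, ⟪∫ σ in s..T, g σ, w s⟫ = ∫ σ in t..T, ⟪g σ, ∫ s in t..σ, w s⟫ := by
  set μ := (volume : Measure ℝ).restrict (Ioc t T) with hμ
  have hwμ : Integrable w μ := (intervalIntegrable_iff_integrableOn_Ioc_of_le htT).1 hw
  have hgμ : Integrable g μ :=
    (intervalIntegrable_iff_integrableOn_Ioc_of_le htT).1 (hg.intervalIntegrable t T)
  have hop : Integrable (fun z : ℝ × ℝ => ⟪g z.2, w z.1⟫) (μ.prod μ) :=
    hwμ.op_fst_snd (op := fun x y => ⟪y, x⟫) (by fun_prop)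
      ⟨1, fun x y => by simpa [mul_comm] using norm_inner_le_norm (𝕜 := ℝ) y x⟩ hgμ
  have hmeas : MeasurableSet {z : ℝ × ℝ | z.1 < z.2} := measurableSet_lt measurable_fst measurable_snd
  have hswap := integral_integral_swap
    (f := fun s σ => {z : ℝ × ℝ | z.1 < z.2}.indicator (fun z => ⟪g z.2, w z.1⟫) (s, σ))
    (hop.indicator hmeas)
  rw [intervalIntegral.integral_of_le htT, intervalIntegral.integral_of_le htT]
  have hleft : ∀ s ∈ Ioc t T, ⟪∫ σ in s..T, g σ, w s⟫
      = ∫ σ, {z : ℝ × ℝ | z.1 < z.2}.indicator (fun z => ⟪g z.2, w z.1⟫) (s, σ) ∂μ := by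
    intro s hs
    have : (fun σ => {z : ℝ × ℝ | z.1 < z.2}.indicator (fun z => ⟪g z.2, w z.1⟫) (s, σ))
        = (Ioi s).indicator fun σ => ⟪g σ, w s⟫ := by
      ext σ; simp [indicator]
    rw [this, integral_indicator measurableSet_Ioi, hμ, Measure.restrict_restrict measurableSet_Ioi,
      inter_comm, Ioc_inter_Ioi, sup_eq_right.2 hs.1.le, ← intervalIntegral.integral_of_le hs.2]
    have := (innerSL ℝ (w s)).intervalIntegral_comp_comm (hg.intervalIntegrable s T)
      (μ := volume)
    simpa [real_inner_comm] using this.symm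
  have hright : ∀ σ ∈ Ioc t T, ⟪g σ, ∫ s in t..σ, w s⟫
      = ∫ s, {z : ℝ × ℝ | z.1 < z.2}.indicator (fun z => ⟪g z.2, w z.1⟫) (s, σ) ∂μ := by
    intro σ hσ
    have : (fun s => {z : ℝ × ℝ | z.1 < z.2}.indicator (fun z => ⟪g z.2, w z.1⟫) (s, σ))
        = (Iio σ).indicator fun s => ⟪g σ, w s⟫ := by
      ext s; simp [indicator]
    rw [this, integral_indicator measurableSet_Iio, hμ, Measure.restrict_restrict measurableSet_Iio]
    have hset : Iio σ ∩ Ioc t T = Ioo t σ := by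
      ext s; simp only [mem_inter_iff, mem_Iio, mem_Ioc, mem_Ioo]
      exact ⟨fun h => ⟨h.2.1, h.1⟩, fun h => ⟨h.2, h.1, h.2.le.trans hσ.2⟩⟩
    rw [hset, ← integral_Ioc_eq_integral_Ioo, ← intervalIntegral.integral_of_le hσ.1.le]
    have := (innerSL ℝ (g σ)).intervalIntegral_comp_comm (μ := volume)
      (hw.mono_set (by rw [uIcc_of_le hσ.1.le, uIcc_of_le htT]; exact Icc_subset_Icc_right hσ.2))
    simpa using this.symm
  rw [setIntegral_congr_fun measurableSet_Ioc hleft, setIntegral_congr_fun measurableSet_Ioc hright]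
  exact hswap

omit [CompleteSpace H] in
/-- If a function has a first-order expansion with quadratic remainder at every point, then the
first-order term is a Lipschitz function of the point. -/
lemma lipschitz_of_abs_sub_sub_inner_le {V : H → ℝ} {G : H → H} {K : ℝ} (hK : 0 < K)
    (h : ∀ X X', |V X' - V X - ⟪G X, X' - X⟫| ≤ K * ‖X' - X‖ ^ 2) (X X' : H) :
    ‖G X' - G X‖ ≤ 6 * K * ‖X' - X‖ := by
  set d := G X' - G X with hd
  set ξ := X' - X with hξ
  set ρ : ℝ := 1 / (6 * K) with hρ
  have hρK : K * ρ = 1 / 6 := by rw [hρ]; field_simp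
  have h1 := abs_le.1 (h X X')
  have h2 := abs_le.1 (h X (X' + ρ • d))
  have h3 := abs_le.1 (h X' (X' + ρ • d))
  have e1 : X' + ρ • d - X = ξ + ρ • d := by rw [hξ]; abel
  have e2 : X' + ρ • d - X' = ρ • d := by abel
  have e3 : ⟪G X', ρ • d⟫ - ⟪G X, ρ • d⟫ = ρ * ‖d‖ ^ 2 := by
    rw [← inner_sub_left, ← hd, inner_smul_right, real_inner_self_eq_norm_sq]
  have e4 : ‖ξ + ρ • d‖ ^ 2 ≤ 2 * ‖ξ‖ ^ 2 + 2 * ‖ρ • d‖ ^ 2 := by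
    have := parallelogram_law_with_norm ℝ ξ (ρ • d)
    nlinarith [sq_nonneg ‖ξ - ρ • d‖]
  have e5 : ‖ρ • d‖ ^ 2 = ρ ^ 2 * ‖d‖ ^ 2 := by rw [norm_smul, mul_pow, Real.norm_eq_abs, sq_abs]
  rw [e1, inner_add_right] at h2
  rw [e2] at h3
  have e6 : K * ‖ξ + ρ • d‖ ^ 2 ≤ K * (2 * ‖ξ‖ ^ 2 + 2 * ‖ρ • d‖ ^ 2) := by gcongr
  have h4 : ρ * ‖d‖ ^ 2 ≤ 3 * K * ‖ξ‖ ^ 2 + 3 * (K * ρ) * ρ * ‖d‖ ^ 2 := by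
    rw [e5] at h3 e6
    nlinarith [h1.1, h1.2, h2.1, h2.2, h3.1, h3.2]
  rw [hρK] at h4
  have h5 : (K * ρ) * ‖d‖ ^ 2 ≤ 6 * K ^ 2 * ‖ξ‖ ^ 2 := by nlinarith
  rw [hρK] at h5
  exact (sq_le_sq₀ (norm_nonneg _) (by positivity)).1 (by nlinarith)

lemma hasGradientAt_of_abs_sub_sub_inner_le {V : H → ℝ} {X G : H} {K : ℝ}
    (h : ∀ X', |V X' - V X - ⟪G, X' - X⟫| ≤ K * ‖X' - X‖ ^ 2) : HasGradientAt V G X := by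
  rw [hasGradientAt_iff_isLittleO]
  refine IsBigO.trans_isLittleO (g := fun X' => ‖X' - X‖ ^ 2) ?_
    (isLittleO_pow_sub_sub X one_lt_two)
  exact IsBigO.of_bound K (Eventually.of_forall fun X' => by simpa using h X')

/-- A continuous path `Y` solves the two-point boundary value problem of the maximum principle on
`[t, T]`, written as an integral equation. -/
def IsExtremal (DF DFT : H → H) (lam T : ℝ) (X : H) (t : ℝ) (Y : ℝ → H) : Prop :=
  Continuous Y ∧
    ∀ s ∈ Icc t T, Y s = X - (1 / lam) • ∫ σ in t..s, adjZ DF DFT T Y σ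

section Extremal

variable {F FT : H → ℝ} {DF DFT : H → H} {c T lam t : ℝ} {X : H} {Y : ℝ → H}

omit [InnerProductSpace ℝ H] [CompleteSpace H] in
lemma continuous_of_norm_sub_le (hDF : ∀ X₁ X₂ : H, ‖DF X₁ - DF X₂‖ ≤ c * ‖X₁ - X₂‖) :
    Continuous DF :=
  (LipschitzWith.of_dist_le' fun a b => by simpa [dist_eq_norm] using hDF a b).continuous

omit [CompleteSpace H] in
lemma continuous_adjZ (hDF : Continuous DF) (hY : Continuous Y) :
    Continuous (adjZ DF DFT T Y) := by
  have h : adjZ DF DFT T Y = fun s => DFT (Y T) - ∫ σ in T..s, DF (Y σ) := by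
    ext s
    rw [adjZ, intervalIntegral.integral_symm, sub_eq_add_neg]
  rw [h]
  exact continuous_const.sub (intervalIntegral.continuous_primitive
    (fun a b => (hDF.comp hY).intervalIntegrable a b) T)

omit [CompleteSpace H] in
lemma adjZ_sub_adjZ (hDF : Continuous DF) (hY : Continuous Y) (r s : ℝ) :
    adjZ DF DFT T Y r - adjZ DF DFT T Y s = ∫ σ in r..s, DF (Y σ) := by
  have hi : ∀ a b, IntervalIntegrable (fun σ => DF (Y σ)) volume a b :=
    fun a b => (hDF.comp hY).intervalIntegrable a b
  rw [adjZ, adjZ, add_sub_add_left_eq_sub, sub_eq_iff_eq_add,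
    intervalIntegral.integral_add_adjacent_intervals (hi _ _) (hi _ _)]

omit [CompleteSpace H] in
lemma IsExtremal.apply_left (h : IsExtremal DF DFT lam T X t Y) (htT : t ≤ T) : Y t = X := by
  simpa using h.2 t (left_mem_Icc.2 htT)

omit [CompleteSpace H] in
lemma IsExtremal.sub_apply (hDF : Continuous DF) (h : IsExtremal DF DFT lam T X t Y) {r s : ℝ}
    (hr : r ∈ Icc t T) (hs : s ∈ Icc t T) :
    Y r - Y s = (1 / lam) • ∫ σ in r..s, adjZ DF DFT T Y σ := by
  have hi : ∀ a b, IntervalIntegrable (adjZ DF DFT T Y) volume a b :=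
    fun a b => (continuous_adjZ hDF h.1).intervalIntegrable a b
  rw [h.2 r hr, h.2 s hs, sub_sub_sub_cancel_left, ← smul_sub,
    intervalIntegral.integral_interval_sub_left (hi _ _) (hi _ _)]

omit [CompleteSpace H] in
lemma IsExtremal.restrict (hDF : Continuous DF) (h : IsExtremal DF DFT lam T X t Y) {s : ℝ}
    (hs : s ∈ Icc t T) : IsExtremal DF DFT lam T (Y s) s Y := by
  refine ⟨h.1, fun r hr => ?_⟩
  have := h.sub_apply hDF hs (r := s) (s := r) ⟨hs.1.trans hr.1, hr.2⟩
  rw [← this]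
  abel

omit [CompleteSpace H] in
/-- The adjoint state depends on the path in a Lipschitz way. -/
lemma norm_adjZ_sub_adjZ_le {Y₁ Y₂ : ℝ → H} {M s : ℝ} (hc : 0 ≤ c)
    (hDF : ∀ X₁ X₂ : H, ‖DF X₁ - DF X₂‖ ≤ c * ‖X₁ - X₂‖)
    (hDFT : ∀ X₁ X₂ : H, ‖DFT X₁ - DFT X₂‖ ≤ c * ‖X₁ - X₂‖)
    (hY₁ : Continuous Y₁) (hY₂ : Continuous Y₂) (ht : 0 ≤ t)
    (hM : ∀ σ ∈ Icc t T, ‖Y₁ σ - Y₂ σ‖ ≤ M) (hs : s ∈ Icc t T) :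
    ‖adjZ DF DFT T Y₁ s - adjZ DF DFT T Y₂ s‖ ≤ c * (1 + T) * M := by
  have hDFc := continuous_of_norm_sub_le hDF
  have hM0 : 0 ≤ M := (norm_nonneg _).trans (hM s hs)
  have hi : ∀ {y : ℝ → H}, Continuous y → IntervalIntegrable (fun σ => DF (y σ)) volume s T :=
    fun hy => (hDFc.comp hy).intervalIntegrable s T
  rw [adjZ, adjZ, add_sub_add_comm, ← intervalIntegral.integral_sub (hi hY₁) (hi hY₂)]
  have h1 : ‖DFT (Y₁ T) - DFT (Y₂ T)‖ ≤ c * M :=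
    (hDFT _ _).trans (by gcongr; exact hM T ⟨hs.1.trans hs.2, le_rfl⟩)
  have h2 : ‖∫ σ in s..T, (DF (Y₁ σ) - DF (Y₂ σ))‖ ≤ c * M * |T - s| := by
    refine intervalIntegral.norm_integral_le_of_norm_le_const fun σ hσ => ?_
    rw [uIoc_of_le hs.2] at hσ
    exact (hDF _ _).trans (by gcongr; exact hM σ ⟨hs.1.trans hσ.1.le, hσ.2⟩)
  have h3 : |T - s| ≤ T := by
    rw [abs_of_nonneg (sub_nonneg.2 hs.2)]
    linarith [hs.1]
  calc _ ≤ _ := norm_add_le _ _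
    _ ≤ c * M + c * M * T := by gcongr; exact h2.trans (by gcongr)
    _ = _ := by ring

omit [InnerProductSpace ℝ H] [CompleteSpace H] in
lemma norm_le_of_lipschitz (hDF : ∀ X₁ X₂ : H, ‖DF X₁ - DF X₂‖ ≤ c * ‖X₁ - X₂‖)
    (hDF0 : ‖DF 0‖ ≤ c) (x : H) : ‖DF x‖ ≤ c * (1 + ‖x‖) := by
  have h1 := hDF x 0
  have h2 := norm_le_norm_add_norm_sub' (DF x) (DF 0)
  rw [sub_zero] at h1
  linarith

omit [CompleteSpace H] in
lemma norm_adjZ_le {M s : ℝ} (hc : 0 ≤ c)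
    (hDF : ∀ X₁ X₂ : H, ‖DF X₁ - DF X₂‖ ≤ c * ‖X₁ - X₂‖)
    (hDFT : ∀ X₁ X₂ : H, ‖DFT X₁ - DFT X₂‖ ≤ c * ‖X₁ - X₂‖)
    (hDF0 : ‖DF 0‖ ≤ c) (hDFT0 : ‖DFT 0‖ ≤ c) (ht : 0 ≤ t)
    (hM : ∀ σ ∈ Icc t T, ‖Y σ‖ ≤ M) (hs : s ∈ Icc t T) :
    ‖adjZ DF DFT T Y s‖ ≤ c * (1 + T) * (1 + M) := by
  have hM0 : 0 ≤ M := (norm_nonneg _).trans (hM s hs)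
  have h1 : ‖DFT (Y T)‖ ≤ c * (1 + M) :=
    (norm_le_of_lipschitz hDFT hDFT0 _).trans (by gcongr; exact hM T ⟨hs.1.trans hs.2, le_rfl⟩)
  have h2 : ‖∫ σ in s..T, DF (Y σ)‖ ≤ c * (1 + M) * |T - s| := by
    refine intervalIntegral.norm_integral_le_of_norm_le_const fun σ hσ => ?_
    rw [uIoc_of_le hs.2] at hσ
    exact (norm_le_of_lipschitz hDF hDF0 _).trans
      (by gcongr; exact hM σ ⟨hs.1.trans hσ.1.le, hσ.2⟩)
  have h3 : |T - s| ≤ T := by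
    rw [abs_of_nonneg (sub_nonneg.2 hs.2)]
    linarith [hs.1]
  calc _ ≤ _ := norm_add_le _ _
    _ ≤ c * (1 + M) + c * (1 + M) * T := by gcongr; exact h2.trans (by gcongr)
    _ = _ := by ring

omit [CompleteSpace H] in
/-- A priori bound on extremal paths, depending only on the norm of the starting point. -/
lemma IsExtremal.norm_le (hc : 0 ≤ c) (hlam : 0 < lam) (hlc : c * T * (1 + T) < lam)
    (hDF : ∀ X₁ X₂ : H, ‖DF X₁ - DF X₂‖ ≤ c * ‖X₁ - X₂‖)
    (hDFT : ∀ X₁ X₂ : H, ‖DFT X₁ - DFT X₂‖ ≤ c * ‖X₁ - X₂‖)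
    (hDF0 : ‖DF 0‖ ≤ c) (hDFT0 : ‖DFT 0‖ ≤ c) (ht : t ∈ Icc 0 T)
    (h : IsExtremal DF DFT lam T X t Y) {s : ℝ} (hs : s ∈ Icc t T) :
    ‖Y s‖ ≤ (lam * ‖X‖ + lam) / (lam - c * T * (1 + T)) := by
  obtain ⟨s₀, hs₀, hmax⟩ := isCompact_Icc.exists_isMaxOn (nonempty_Icc.2 ht.2)
    h.1.norm.continuousOn
  refine (hmax hs).trans ?_
  rw [le_div_iff₀ (sub_pos.2 hlc)]
  set m := ‖Y s₀‖ with hm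
  have hT : 0 ≤ T := ht.1.trans ht.2
  have hint : ‖∫ σ in t..s₀, adjZ DF DFT T Y σ‖ ≤ c * (1 + T) * (1 + m) * |s₀ - t| := by
    refine intervalIntegral.norm_integral_le_of_norm_le_const fun σ hσ => ?_
    rw [uIoc_of_le hs₀.1] at hσ
    exact norm_adjZ_le hc hDF hDFT hDF0 hDFT0 ht.1 (fun σ hσ => hmax hσ)
      ⟨hσ.1.le, hσ.2.trans hs₀.2⟩
  have h3 : |s₀ - t| ≤ T := by
    rw [abs_of_nonneg (sub_nonneg.2 hs₀.1)]
    linarith [hs₀.2, ht.1]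
  have h4 : m ≤ ‖X‖ + 1 / lam * (c * (1 + T) * (1 + m) * T) := by
    rw [hm, h.2 s₀ hs₀]
    refine (norm_sub_le _ _).trans ?_
    rw [norm_smul, Real.norm_of_nonneg (by positivity), ← h.2 s₀ hs₀, ← hm]
    gcongr
    exact hint.trans (by gcongr)
  have h5 : lam * m ≤ lam * ‖X‖ + c * (1 + T) * (1 + m) * T := by
    calc lam * m ≤ lam * (‖X‖ + 1 / lam * (c * (1 + T) * (1 + m) * T)) := by gcongr
      _ = _ := by field_simp
  nlinarith

/-- Extremal paths exist, by the contraction principle. -/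
lemma exists_isExtremal (hc : 0 ≤ c) (hlam : 0 < lam) (hlc : c * T * (1 + T) < lam)
    (hDF : ∀ X₁ X₂ : H, ‖DF X₁ - DF X₂‖ ≤ c * ‖X₁ - X₂‖)
    (hDFT : ∀ X₁ X₂ : H, ‖DFT X₁ - DFT X₂‖ ≤ c * ‖X₁ - X₂‖)
    (ht : t ∈ Icc 0 T) (X : H) : ∃ Y, IsExtremal DF DFT lam T X t Y := by
  have hDFc := continuous_of_norm_sub_le hDF
  have hT : 0 ≤ T := ht.1.trans ht.2
  have hadj : ∀ y : C(Icc t T, H), Continuous (adjZ DF DFT T (IccExtend ht.2 y)) :=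
    fun y => continuous_adjZ hDFc (y.continuous.Icc_extend')
  let Φ : C(Icc t T, H) → C(Icc t T, H) := fun y =>
    ⟨fun s => X - (1 / lam) • ∫ σ in t..s, adjZ DF DFT T (IccExtend ht.2 y) σ, by
      have := intervalIntegral.continuous_primitive
        (fun a b => (hadj y).intervalIntegrable (μ := volume) a b) t
      fun_prop⟩
  let k : NNReal := ⟨c * T * (1 + T) / lam, by positivity⟩
  have hΦ : ContractingWith k Φ := by
    refine ⟨by rw [← NNReal.coe_lt_coe]; exact (div_lt_one hlam).2 hlc,
      LipschitzWith.of_dist_le_mul fun y₁ y₂ => ?_⟩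
    rw [ContinuousMap.dist_le (by positivity)]
    intro s
    have hext : ∀ σ ∈ Icc t T, ‖IccExtend ht.2 y₁ σ - IccExtend ht.2 y₂ σ‖ ≤ dist y₁ y₂ := by
      intro σ hσ
      rw [IccExtend_of_mem _ _ hσ, IccExtend_of_mem _ _ hσ, ← dist_eq_norm]
      exact ContinuousMap.dist_apply_le_dist _
    have hint : ‖∫ σ in t..s, (adjZ DF DFT T (IccExtend ht.2 y₂) σ
        - adjZ DF DFT T (IccExtend ht.2 y₁) σ)‖ ≤ c * (1 + T) * dist y₁ y₂ * |s - t| := by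
      refine intervalIntegral.norm_integral_le_of_norm_le_const fun σ hσ => ?_
      rw [uIoc_of_le s.2.1] at hσ
      rw [norm_sub_rev]
      exact norm_adjZ_sub_adjZ_le hc hDF hDFT y₁.continuous.Icc_extend' y₂.continuous.Icc_extend'
        ht.1 hext ⟨hσ.1.le, hσ.2.trans s.2.2⟩
    have h3 : |s - t| ≤ T := by
      rw [abs_of_nonneg (sub_nonneg.2 s.2.1)]
      linarith [s.2.2, ht.1]
    calc dist (Φ y₁ s) (Φ y₂ s)
        = 1 / lam * ‖∫ σ in t..s, (adjZ DF DFT T (IccExtend ht.2 y₂) σ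
            - adjZ DF DFT T (IccExtend ht.2 y₁) σ)‖ := by
          rw [intervalIntegral.integral_sub ((hadj y₂).intervalIntegrable _ _)
            ((hadj y₁).intervalIntegrable _ _), dist_eq_norm]
          simp only [Φ, ContinuousMap.coe_mk]
          rw [sub_sub_sub_cancel_left, ← smul_sub, norm_smul, Real.norm_of_nonneg (by positivity)]
      _ ≤ 1 / lam * (c * (1 + T) * dist y₁ y₂ * T) := by
          gcongr
          exact hint.trans (by gcongr)
      _ = k * dist y₁ y₂ := by
          change _ = c * T * (1 + T) / lam * dist y₁ y₂
          ring
  have hfix := hΦ.fixedPoint_isFixedPt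
  set y := hΦ.fixedPoint Φ
  refine ⟨IccExtend ht.2 y, y.continuous.Icc_extend', fun s hs => ?_⟩
  rw [IccExtend_of_mem _ _ hs]
  exact (congrArg (fun z : C(Icc t T, H) => z ⟨s, hs⟩) hfix).symm

end Extremal

section Expansion

variable {F FT : H → ℝ} {DF DFT : H → H} {c T lam t : ℝ} {X : H} {Y : ℝ → H}

omit [CompleteSpace H] in
lemma intervalIntegrable_inner_of_continuous {a b : ℝ} {u w : ℝ → H} (hu : Continuous u)
    (hw : IntervalIntegrable w volume a b) :
    IntervalIntegrable (fun s => ⟪u s, w s⟫) volume a b :=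
  (hw.norm.continuousOn_mul hu.norm.continuousOn).mono_fun'
    (hu.aestronglyMeasurable.inner hw.aestronglyMeasurable_restrict_uIoc)
    (Eventually.of_forall fun _ => norm_inner_le_norm _ _)

omit [CompleteSpace H] in
lemma intervalIntegrable_norm_sub_sq {a b : ℝ} {u v : ℝ → H} (hu : Continuous u)
    (hv : IntervalIntegrable v volume a b)
    (hv2 : IntervalIntegrable (fun s => ‖v s‖ ^ 2) volume a b) :
    IntervalIntegrable (fun s => ‖v s - u s‖ ^ 2) volume a b := by
  have h : (fun s => ‖v s - u s‖ ^ 2) = fun s => ‖v s‖ ^ 2 - 2 * ⟪u s, v s⟫ + ‖u s‖ ^ 2 := by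
    ext s
    rw [norm_sub_sq_real, real_inner_comm]
  rw [h]
  exact (hv2.sub ((intervalIntegrable_inner_of_continuous hu hv).const_mul 2)).add
    ((hu.norm.pow 2).intervalIntegrable _ _)

/-- The feedback control associated with a path `Y`. -/
noncomputable def extremalControl (DF DFT : H → H) (lam T : ℝ) (Y : ℝ → H) (s : ℝ) : H :=
  -(1 / lam) • adjZ DF DFT T Y s

omit [CompleteSpace H] in
lemma continuous_extremalControl (hDF : Continuous DF) (hY : Continuous Y) :
    Continuous (extremalControl DF DFT lam T Y) :=
  (continuous_adjZ hDF hY).const_smul (-(1 / lam))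

omit [CompleteSpace H] in
lemma admissible_extremalControl (hDF : Continuous DF) (hY : Continuous Y) :
    Admissible t T (extremalControl DF DFT lam T Y) :=
  ⟨(continuous_extremalControl hDF hY).intervalIntegrable _ _,
    ((continuous_extremalControl hDF hY).norm.pow 2).intervalIntegrable _ _⟩

omit [CompleteSpace H] in
lemma IsExtremal.state_eq (h : IsExtremal DF DFT lam T X t Y) {s : ℝ} (hs : s ∈ Icc t T) :
    state X t (extremalControl DF DFT lam T Y) s = Y s := by
  rw [h.2 s hs, state]
  simp only [extremalControl]
  rw [intervalIntegral.integral_smul, neg_smul, sub_eq_add_neg]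

lemma integral_adjZ_inner (hDF : Continuous DF) (hY : Continuous Y) (htT : t ≤ T)
    {w : ℝ → H} (hw : IntervalIntegrable w volume t T) (ξ : H) :
    ∫ s in t..T, ⟪adjZ DF DFT T Y s, w s⟫ =
      ⟪DFT (Y T), ξ + ∫ s in t..T, w s⟫ + (∫ s in t..T, ⟪DF (Y s), ξ + ∫ σ in t..s, w σ⟫)
        - ⟪adjZ DF DFT T Y t, ξ⟫ := by
  have hg : Continuous fun s => DF (Y s) := hDF.comp hY
  have hprim : ContinuousOn (fun s => ∫ σ in t..s, w σ) (uIcc t T) :=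
    intervalIntegral.continuousOn_primitive_interval' hw left_mem_uIcc
  have h1 : ∫ s in t..T, ⟪adjZ DF DFT T Y s, w s⟫ =
      (∫ s in t..T, ⟪DFT (Y T), w s⟫) + ∫ s in t..T, ⟪∫ σ in s..T, DF (Y σ), w s⟫ := by
    have hc2 : Continuous fun s => ∫ σ in s..T, DF (Y σ) := by
      have := (continuous_adjZ (DFT := DFT) (T := T) hDF hY).sub
        (continuous_const (y := DFT (Y T)))
      exact this.congr fun s => add_sub_cancel_left _ _
    rw [← intervalIntegral.integral_add
      (intervalIntegrable_inner_of_continuous continuous_const hw)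
      (intervalIntegrable_inner_of_continuous hc2 hw)]
    simp only [adjZ, inner_add_left]
  have h2 : ∫ s in t..T, ⟪DFT (Y T), w s⟫ = ⟪DFT (Y T), ∫ s in t..T, w s⟫ := by
    simpa using (innerSL ℝ (DFT (Y T))).intervalIntegral_comp_comm hw
  have h3 : ∫ s in t..T, ⟪DF (Y s), ξ⟫ = ⟪∫ s in t..T, DF (Y s), ξ⟫ := by
    simpa [real_inner_comm] using
      (innerSL ℝ ξ).intervalIntegral_comp_comm (μ := volume) (hg.intervalIntegrable t T)
  have h4 : ∫ s in t..T, ⟪DF (Y s), ξ + ∫ σ in t..s, w σ⟫ =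
      ⟪∫ s in t..T, DF (Y s), ξ⟫ + ∫ s in t..T, ⟪DF (Y s), ∫ σ in t..s, w σ⟫ := by
    simp only [inner_add_right]
    rw [intervalIntegral.integral_add ((hg.inner continuous_const).intervalIntegrable _ _)
      (hg.continuousOn.inner hprim).intervalIntegrable, h3]
  rw [h1, h2, integral_inner_integral_swap htT hg hw, h4, adjZ, inner_add_left, inner_add_right]
  ring

/-- Second-order expansion of the cost around an extremal control. -/
lemma IsExtremal.abs_cost_sub_le (hc : 0 ≤ c) (hlam : 0 < lam)
    (hF : ∀ X, HasGradientAt F (DF X) X) (hFT : ∀ X, HasGradientAt FT (DFT X) X)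
    (hDF : ∀ X₁ X₂ : H, ‖DF X₁ - DF X₂‖ ≤ c * ‖X₁ - X₂‖)
    (hDFT : ∀ X₁ X₂ : H, ‖DFT X₁ - DFT X₂‖ ≤ c * ‖X₁ - X₂‖)
    (ht : t ∈ Icc 0 T) (h : IsExtremal DF DFT lam T X t Y) {η : ℝ} (hη : 0 < η)
    (X' : H) {v : ℝ → H} (hv : Admissible t T v) :
    |cost F FT lam X' t T v - cost F FT lam X t T (extremalControl DF DFT lam T Y)
        - ⟪adjZ DF DFT T Y t, X' - X⟫
        - lam / 2 * ∫ s in t..T, ‖v s - extremalControl DF DFT lam T Y s‖ ^ 2|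
      ≤ c / 2 * (1 + T) * ((1 + 1 / η) * ‖X' - X‖ ^ 2
        + (1 + η) * (T * ∫ s in t..T, ‖v s - extremalControl DF DFT lam T Y s‖ ^ 2)) := by
  have hDFc := continuous_of_norm_sub_le hDF
  have hFc : Continuous F := continuous_iff_continuousAt.2 fun x => (hF x).continuousAt
  have hT : 0 ≤ T := ht.1.trans ht.2
  set Z := adjZ DF DFT T Y with hZ
  set u := extremalControl DF DFT lam T Y with hu
  have huc : Continuous u := continuous_extremalControl hDFc h.1
  set w : ℝ → H := fun s => v s - u s with hw
  have hwi : IntervalIntegrable w volume t T := hv.1.sub (huc.intervalIntegrable _ _)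
  have hw2 : IntervalIntegrable (fun s => ‖w s‖ ^ 2) volume t T :=
    intervalIntegrable_norm_sub_sq huc hv.1 hv.2
  set Q := ∫ s in t..T, ‖w s‖ ^ 2 with hQ
  have hQ0 : 0 ≤ Q := intervalIntegral.integral_nonneg ht.2 fun _ _ => sq_nonneg _
  set ξ := X' - X with hξ
  have hδ : ∀ s ∈ Icc t T, state X' t v s - Y s = ξ + ∫ σ in t..s, w σ := by
    intro s hs
    have hsub : uIcc t s ⊆ uIcc t T := by
      rw [uIcc_of_le hs.1, uIcc_of_le ht.2]; exact Icc_subset_Icc_right hs.2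
    rw [← h.state_eq hs, hw, intervalIntegral.integral_sub (hv.1.mono_set hsub)
      (huc.intervalIntegrable _ _), state, state, hξ]
    abel
  have hprim : ∀ {f : ℝ → H}, IntervalIntegrable f volume t T →
      ContinuousOn (fun s => ∫ σ in t..s, f σ) (uIcc t T) := fun hf =>
    intervalIntegral.continuousOn_primitive_interval' hf left_mem_uIcc
  have hδsq : ∀ s ∈ Icc t T, ‖ξ + ∫ σ in t..s, w σ‖ ^ 2
      ≤ (1 + 1 / η) * ‖ξ‖ ^ 2 + (1 + η) * (T * Q) := by
    intro s hs
    have hsub : uIcc t s ⊆ uIcc t T := by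
      rw [uIcc_of_le hs.1, uIcc_of_le ht.2]; exact Icc_subset_Icc_right hs.2
    have h1 := sq_norm_intervalIntegral_le hs.1 (hwi.mono_set hsub) (hw2.mono_set hsub)
    have h2 : ∫ σ in t..s, ‖w σ‖ ^ 2 ≤ Q :=
      intervalIntegral.integral_mono_interval le_rfl hs.1 hs.2
        (Eventually.of_forall fun _ => sq_nonneg _) hw2
    have h3 : ‖∫ σ in t..s, w σ‖ ^ 2 ≤ T * Q := h1.trans (by
      have : s - t ≤ T := by linarith [hs.2, ht.1]
      gcongr
      exact intervalIntegral.integral_nonneg hs.1 fun _ _ => sq_nonneg _)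
    set x := ‖ξ‖
    set y := ‖∫ σ in t..s, w σ‖
    have h4 : 2 * x * y ≤ 1 / η * x ^ 2 + η * y ^ 2 := by
      have h5 : 1 / η * x ^ 2 + η * y ^ 2 - 2 * x * y = 1 / η * (x - η * y) ^ 2 := by
        field_simp
        ring
      have h6 : 0 ≤ 1 / η * (x - η * y) ^ 2 := by positivity
      linarith
    calc ‖ξ + ∫ σ in t..s, w σ‖ ^ 2 ≤ (x + y) ^ 2 := by gcongr; exact norm_add_le _ _
      _ ≤ (1 + 1 / η) * x ^ 2 + (1 + η) * y ^ 2 := by linarith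
      _ ≤ _ := by gcongr
  set D := (1 + 1 / η) * ‖ξ‖ ^ 2 + (1 + η) * (T * Q) with hD
  have e1 : ∫ s in t..T, ‖v s‖ ^ 2
      = (∫ s in t..T, ‖u s‖ ^ 2) + 2 * (∫ s in t..T, ⟪u s, w s⟫) + Q := by
    have hui : IntervalIntegrable (fun s => ‖u s‖ ^ 2) volume t T :=
      (huc.norm.pow 2).intervalIntegrable _ _
    have huwi := (intervalIntegrable_inner_of_continuous huc hwi).const_mul 2
    rw [hQ, ← intervalIntegral.integral_const_mul, ← intervalIntegral.integral_add hui huwi,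
      ← intervalIntegral.integral_add (hui.add huwi) hw2]
    congr 1
    ext s
    rw [← norm_add_sq_real, hw, add_sub_cancel]
  have e2 : ∫ s in t..T, ⟪u s, w s⟫ = -(1 / lam) * ∫ s in t..T, ⟪Z s, w s⟫ := by
    rw [← intervalIntegral.integral_const_mul]
    congr 1
    ext s
    rw [hu, extremalControl, real_inner_smul_left]
  have e3 := integral_adjZ_inner (DFT := DFT) hDFc h.1 ht.2 hwi ξ
  have hcont : ContinuousOn (state X' t v) (uIcc t T) := continuousOn_const.add (hprim hv.1)
  have hFi : IntervalIntegrable (fun s => F (state X' t v s)) volume t T :=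
    (hFc.comp_continuousOn hcont).intervalIntegrable
  have hFYi : IntervalIntegrable (fun s => F (Y s)) volume t T :=
    (hFc.comp h.1).intervalIntegrable _ _
  have hIi : IntervalIntegrable (fun s => ⟪DF (Y s), ξ + ∫ σ in t..s, w σ⟫) volume t T :=
    ((hDFc.comp h.1).continuousOn.inner
      (continuousOn_const.add (hprim hwi))).intervalIntegrable
  have e4 : ∫ s in t..T, (F (state X' t v s) - F (Y s) - ⟪DF (Y s), ξ + ∫ σ in t..s, w σ⟫)
      = (∫ s in t..T, F (state X' t v s)) - (∫ s in t..T, F (Y s))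
        - ∫ s in t..T, ⟪DF (Y s), ξ + ∫ σ in t..s, w σ⟫ := by
    rw [intervalIntegral.integral_sub (hFi.sub hFYi) hIi, intervalIntegral.integral_sub hFi hFYi]
  have e5 : ∫ s in t..T, F (state X t u s) = ∫ s in t..T, F (Y s) :=
    intervalIntegral.integral_congr fun s hs => by
      rw [uIcc_of_le ht.2] at hs
      simp only [hu, h.state_eq hs]
  have hTm : T ∈ Icc t T := right_mem_Icc.2 ht.2
  have b1 : ‖∫ s in t..T, (F (state X' t v s) - F (Y s) - ⟪DF (Y s), ξ + ∫ σ in t..s, w σ⟫)‖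
      ≤ c / 2 * D * |T - t| := by
    refine intervalIntegral.norm_integral_le_of_norm_le_const fun s hs => ?_
    rw [uIoc_of_le ht.2] at hs
    have hs' := Ioc_subset_Icc_self hs
    have := abs_sub_sub_inner_le_of_lipschitz_gradient hF hDF (Y s) (state X' t v s)
    rw [hδ s hs'] at this
    exact this.trans (by gcongr; exact hδsq s hs')
  have b2 : |FT (state X' t v T) - FT (Y T) - ⟪DFT (Y T), ξ + ∫ σ in t..T, w σ⟫|
      ≤ c / 2 * D := by
    have := abs_sub_sub_inner_le_of_lipschitz_gradient hFT hDFT (Y T) (state X' t v T)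
    rw [hδ T hTm] at this
    exact this.trans (by gcongr; exact hδsq T hTm)
  have b3 : c / 2 * D * |T - t| ≤ c / 2 * D * T := by
    rw [abs_of_nonneg (sub_nonneg.2 ht.2)]
    gcongr
    linarith [ht.1]
  have hid : cost F FT lam X' t T v - cost F FT lam X t T u - ⟪Z t, ξ⟫ - lam / 2 * Q
      = (∫ s in t..T, (F (state X' t v s) - F (Y s) - ⟪DF (Y s), ξ + ∫ σ in t..s, w σ⟫))
        + (FT (state X' t v T) - FT (Y T) - ⟪DFT (Y T), ξ + ∫ σ in t..T, w σ⟫) := by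
    rw [cost, cost, e1, e2, e3, e4, e5, h.state_eq hTm]
    field_simp
    ring
  rw [hid]
  calc _ ≤ _ := abs_add_le _ _
    _ ≤ c / 2 * D * T + c / 2 * D := add_le_add (b1.trans b3) b2
    _ = _ := by ring

/-- Along an extremal path the value function is attained, and it admits a first-order expansion
whose quadratic remainder is uniform. -/
lemma exists_abs_valueFn_sub_le (hc : 0 ≤ c) (hlam : 0 < lam) (hT : 0 ≤ T)
    (hlc : c * T * (1 + T) < lam)
    (hF : ∀ X, HasGradientAt F (DF X) X) (hFT : ∀ X, HasGradientAt FT (DFT X) X)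
    (hDF : ∀ X₁ X₂ : H, ‖DF X₁ - DF X₂‖ ≤ c * ‖X₁ - X₂‖)
    (hDFT : ∀ X₁ X₂ : H, ‖DFT X₁ - DFT X₂‖ ≤ c * ‖X₁ - X₂‖) :
    ∃ K : ℝ, 0 < K ∧ ∀ t ∈ Icc 0 T, ∀ X Y, IsExtremal DF DFT lam T X t Y →
      valueFn F FT lam T X t = cost F FT lam X t T (extremalControl DF DFT lam T Y) ∧
      ∀ X', |valueFn F FT lam T X' t - valueFn F FT lam T X t - ⟪adjZ DF DFT T Y t, X' - X⟫|
        ≤ K * ‖X' - X‖ ^ 2 := by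
  set η := (lam - c * T * (1 + T)) / lam with hη
  have hη0 : 0 < η := div_pos (sub_pos.2 hlc) hlam
  have hηlam : (1 + η) * (c * T * (1 + T)) ≤ lam := by
    have h1 : η * (c * T * (1 + T)) ≤ η * lam := by gcongr
    have h2 : η * lam = lam - c * T * (1 + T) := by rw [hη]; field_simp
    linarith
  set K₀ := c / 2 * (1 + T) * (1 + 1 / η) with hK₀
  have hK₀0 : 0 ≤ K₀ := by positivity
  refine ⟨K₀ + 1, by positivity, fun t ht X Y h => ?_⟩
  have hDFc := continuous_of_norm_sub_le hDF
  set u := extremalControl DF DFT lam T Y with hu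
  have huadm : Admissible t T u := admissible_extremalControl hDFc h.1
  have hlow : ∀ X', ∀ v, Admissible t T v →
      cost F FT lam X t T u + ⟪adjZ DF DFT T Y t, X' - X⟫ - K₀ * ‖X' - X‖ ^ 2
        ≤ cost F FT lam X' t T v := by
    intro X' v hv
    have h1 := (abs_le.1 (h.abs_cost_sub_le hc hlam hF hFT hDF hDFT ht hη0 X' hv)).1
    rw [← hu] at h1
    set Q := ∫ s in t..T, ‖v s - u s‖ ^ 2 with hQ
    have hQ0 : 0 ≤ Q := intervalIntegral.integral_nonneg ht.2 fun _ _ => sq_nonneg _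
    have h2 : (1 + η) * (c * T * (1 + T)) * Q ≤ lam * Q := by gcongr
    have h3 : c / 2 * (1 + T) * ((1 + 1 / η) * ‖X' - X‖ ^ 2 + (1 + η) * (T * Q))
        = K₀ * ‖X' - X‖ ^ 2 + (1 + η) * (c * T * (1 + T)) * Q / 2 := by rw [hK₀]; ring
    linarith
  have hbdd : ∀ X', BddBelow ((fun v => cost F FT lam X' t T v) '' {v | Admissible t T v}) :=
    fun X' => ⟨_, by rintro _ ⟨v, hv, rfl⟩; exact hlow X' v hv⟩
  have hval : valueFn F FT lam T X t = cost F FT lam X t T u := by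
    refine IsLeast.csInf_eq ⟨⟨u, huadm, rfl⟩, ?_⟩
    rintro _ ⟨v, hv, rfl⟩
    simpa using hlow X v hv
  refine ⟨hval, fun X' => ?_⟩
  have hsq : 0 ≤ ‖X' - X‖ ^ 2 := sq_nonneg _
  rw [hval, abs_le]
  constructor
  · have : cost F FT lam X t T u + ⟪adjZ DF DFT T Y t, X' - X⟫ - K₀ * ‖X' - X‖ ^ 2
        ≤ valueFn F FT lam T X' t :=
      le_csInf ⟨_, u, huadm, rfl⟩ (by rintro _ ⟨v, hv, rfl⟩; exact hlow X' v hv)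
    linarith
  · have h1 : valueFn F FT lam T X' t ≤ cost F FT lam X' t T u := csInf_le (hbdd X') ⟨u, huadm, rfl⟩
    have h2 := (abs_le.1 (h.abs_cost_sub_le hc hlam hF hFT hDF hDFT ht hη0 X' huadm)).2
    simp only [← hu, sub_self, norm_zero, ne_eq, OfNat.ofNat_ne_zero, not_false_eq_true, zero_pow,
      intervalIntegral.integral_zero, mul_zero, sub_zero, add_zero] at h2
    rw [← mul_assoc, ← hK₀] at h2
    linarith

omit [CompleteSpace H] in
lemma IsExtremal.cost_eq (htT : t ≤ T) (hlam : 0 < lam) (h : IsExtremal DF DFT lam T X t Y) :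
    cost F FT lam X t T (extremalControl DF DFT lam T Y)
      = 1 / (2 * lam) * (∫ s in t..T, ‖adjZ DF DFT T Y s‖ ^ 2) + (∫ s in t..T, F (Y s))
        + FT (Y T) := by
  have h1 : ∫ s in t..T, F (state X t (extremalControl DF DFT lam T Y) s)
      = ∫ s in t..T, F (Y s) :=
    intervalIntegral.integral_congr fun s hs => by
      rw [uIcc_of_le htT] at hs
      simp only [h.state_eq hs]
  have h2 : ∀ s, ‖extremalControl DF DFT lam T Y s‖ ^ 2
      = (1 / lam) ^ 2 * ‖adjZ DF DFT T Y s‖ ^ 2 := fun s => by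
    rw [extremalControl, norm_smul, mul_pow, norm_neg, Real.norm_eq_abs, sq_abs]
  rw [cost, h1, h.state_eq (right_mem_Icc.2 htT)]
  simp_rw [h2]
  rw [intervalIntegral.integral_const_mul]
  field_simp

end Expansion

section TimeRegularity

variable {F FT : H → ℝ} {DF DFT : H → H} {c T lam : ℝ}

lemma norm_integral_sub_smul_le {E : Type*} [NormedAddCommGroup E] [NormedSpace ℝ E]
    [CompleteSpace E] {f : ℝ → E} (hf : Continuous f) {s t C : ℝ} (hst : s ≤ t)
    (h : ∀ σ ∈ Icc s t, ‖f σ - f s‖ ≤ C * (t - s)) :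
    ‖(∫ σ in s..t, f σ) - (t - s) • f s‖ ≤ C * (t - s) ^ 2 := by
  have h1 : (∫ σ in s..t, f σ) - (t - s) • f s = ∫ σ in s..t, (f σ - f s) := by
    rw [intervalIntegral.integral_sub (hf.intervalIntegrable _ _) (by simp),
      intervalIntegral.integral_const]
  rw [h1]
  refine (intervalIntegral.norm_integral_le_of_norm_le_const (C := C * (t - s))
    fun σ hσ => ?_).trans_eq ?_
  · rw [uIoc_of_le hst] at hσ
    exact h σ (Ioc_subset_Icc_self hσ)
  · rw [abs_of_nonneg (sub_nonneg.2 hst)]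
    ring

omit [InnerProductSpace ℝ H] [CompleteSpace H] in
lemma abs_sq_norm_sub_sq_norm_le {a b : H} {M ε : ℝ} (ha : ‖a‖ ≤ M) (hb : ‖b‖ ≤ M)
    (hab : ‖a - b‖ ≤ ε) : |‖a‖ ^ 2 - ‖b‖ ^ 2| ≤ 2 * M * ε := by
  have h1 : |‖a‖ - ‖b‖| ≤ ε := (abs_norm_sub_norm_le a b).trans hab
  have h2 : ‖a‖ ^ 2 - ‖b‖ ^ 2 = (‖a‖ + ‖b‖) * (‖a‖ - ‖b‖) := by ring
  rw [h2, abs_mul, abs_of_nonneg (by positivity)]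
  have : 0 ≤ M := (norm_nonneg a).trans ha
  gcongr
  linarith

lemma hasDerivWithinAt_of_abs_sub_le {f h : ℝ → ℝ} {S : Set ℝ} {K : ℝ}
    (hf : ∀ s ∈ S, ∀ t ∈ S, s ≤ t → |f t - f s - (t - s) * h s| ≤ K * (t - s) ^ 2)
    (hh : ∀ s ∈ S, ∀ t ∈ S, s ≤ t → |h t - h s| ≤ K * (t - s)) {t : ℝ} (ht : t ∈ S) :
    HasDerivWithinAt f (h t) S t := by
  rw [hasDerivWithinAt_iff_isLittleO]
  refine IsBigO.trans_isLittleO (g := fun τ => ‖τ - t‖ ^ 2) (IsBigO.of_bound (2 * |K|) ?_)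
    ((isLittleO_pow_sub_sub t one_lt_two).mono nhdsWithin_le_nhds)
  filter_upwards [self_mem_nhdsWithin] with τ hτ
  have hsq : 0 ≤ (τ - t) ^ 2 := sq_nonneg _
  have hK : K * (τ - t) ^ 2 ≤ |K| * (τ - t) ^ 2 := by gcongr; exact le_abs_self K
  have hK0 : 0 ≤ |K| * (τ - t) ^ 2 := by positivity
  rw [norm_pow, norm_norm, Real.norm_eq_abs, Real.norm_eq_abs, sq_abs, smul_eq_mul]
  rcases le_total t τ with h1 | h1
  · linarith [hf t ht τ hτ h1]
  · have h2 := hf τ hτ t ht h1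
    have h3 := hh τ hτ t ht h1
    have h4 : |(t - τ) * (h τ - h t)| ≤ K * (τ - t) ^ 2 := by
      rw [abs_mul, abs_of_nonneg (sub_nonneg.2 h1), abs_sub_comm]
      calc (t - τ) * |h t - h τ| ≤ (t - τ) * (K * (t - τ)) :=
            mul_le_mul_of_nonneg_left h3 (sub_nonneg.2 h1)
        _ = _ := by ring
    have h5 : f τ - f t - (τ - t) * h t
        = -(f t - f τ - (t - τ) * h τ) - (t - τ) * (h τ - h t) := by ring
    rw [h5]
    refine (abs_sub _ _).trans ?_
    rw [abs_neg]
    have h6 : (t - τ) ^ 2 = (τ - t) ^ 2 := by ring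
    rw [h6] at h2
    linarith

/-- For a fixed state, the gradient of the value function is Lipschitz in time, and so is the
right-hand side of the Hamilton-Jacobi-Bellman equation, which moreover is the first-order term of
an expansion of the value function in time. -/
lemma exists_time_expansion (hc : 0 ≤ c) (hlam : 0 < lam) (hT : 0 ≤ T)
    (hlc : c * T * (1 + T) < lam)
    (hF : ∀ X, HasGradientAt F (DF X) X)
    (hDF : ∀ X₁ X₂ : H, ‖DF X₁ - DF X₂‖ ≤ c * ‖X₁ - X₂‖)
    (hDFT : ∀ X₁ X₂ : H, ‖DFT X₁ - DFT X₂‖ ≤ c * ‖X₁ - X₂‖)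
    (hDF0 : ‖DF 0‖ ≤ c) (hDFT0 : ‖DFT 0‖ ≤ c)
    {V : H → ℝ → ℝ} {G : H → ℝ → H} {K : ℝ} (hK : 0 < K)
    (hV : ∀ t ∈ Icc 0 T, ∀ X Y, IsExtremal DF DFT lam T X t Y →
      V X t = 1 / (2 * lam) * (∫ s in t..T, ‖adjZ DF DFT T Y s‖ ^ 2) + (∫ s in t..T, F (Y s))
        + FT (Y T))
    (hG : ∀ t ∈ Icc 0 T, ∀ X Y, IsExtremal DF DFT lam T X t Y → G X t = adjZ DF DFT T Y t)
    (hVG : ∀ t ∈ Icc 0 T, ∀ X X', |V X' t - V X t - ⟪G X t, X' - X⟫| ≤ K * ‖X' - X‖ ^ 2)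
    (X : H) :
    ∃ L : ℝ, ∀ s ∈ Icc 0 T, ∀ t ∈ Icc 0 T, s ≤ t →
      |V X t - V X s - (t - s) * (1 / (2 * lam) * ‖G X s‖ ^ 2 - F X)| ≤ L * (t - s) ^ 2 ∧
      |(1 / (2 * lam) * ‖G X t‖ ^ 2 - F X) - (1 / (2 * lam) * ‖G X s‖ ^ 2 - F X)|
        ≤ L * (t - s) ∧
      ‖G X t - G X s‖ ≤ L * (t - s) := by
  have hDFc := continuous_of_norm_sub_le hDF
  have hFc : Continuous F := continuous_iff_continuousAt.2 fun x => (hF x).continuousAt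
  set m := (lam * ‖X‖ + lam) / (lam - c * T * (1 + T)) with hm
  have hm0 : 0 ≤ m := div_nonneg (by positivity) (sub_pos.2 hlc).le
  set M := c * (1 + T) * (1 + m) with hM
  have hM0 : 0 ≤ M := by positivity
  have hDFM : ∀ {x : H}, ‖x‖ ≤ m → ‖DF x‖ ≤ M := fun {x} hx => by
    refine (norm_le_of_lipschitz hDF hDF0 x).trans ?_
    calc c * (1 + ‖x‖) ≤ c * (1 + m) := by gcongr
      _ ≤ c * (1 + m) + c * (1 + m) * T := le_add_of_nonneg_right (by positivity)
      _ = M := by rw [hM]; ring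
  have hGM : ∀ t ∈ Icc 0 T, ‖G X t‖ ≤ M := by
    intro t ht
    obtain ⟨Y, hY⟩ := exists_isExtremal hc hlam hlc hDF hDFT ht X
    rw [hG t ht X Y hY]
    exact norm_adjZ_le hc hDF hDFT hDF0 hDFT0 ht.1
      (fun σ hσ => hY.norm_le hc hlam hlc hDF hDFT hDF0 hDFT0 ht hσ) (left_mem_Icc.2 ht.2)
  set P := M / lam with hP
  have hP0 : 0 ≤ P := by positivity
  set A := 1 / (2 * lam) * (2 * M * M) + (M * P + c / 2 * P ^ 2 * T) with hA
  have hA0 : 0 ≤ A := by positivity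
  set L₁ := 6 * K * P + M with hL₁
  have hL₁0 : 0 ≤ L₁ := by positivity
  set L₂ := A + 2 * (M * P) + K * P ^ 2 with hL₂
  set L₃ := 1 / (2 * lam) * (2 * M * L₁) with hL₃
  have hL₂0 : 0 ≤ L₂ := by positivity
  have hL₃0 : 0 ≤ L₃ := by positivity
  refine ⟨L₁ + L₂ + L₃, fun s hs t ht hst => ?_⟩
  have hd : 0 ≤ t - s := sub_nonneg.2 hst
  have hdT : t - s ≤ T := by linarith [hs.1, ht.2]
  obtain ⟨Y, hY⟩ := exists_isExtremal hc hlam hlc hDF hDFT hs X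
  set Z := adjZ DF DFT T Y with hZ
  have hZc : Continuous Z := continuous_adjZ hDFc hY.1
  have hYm : ∀ σ ∈ Icc s T, ‖Y σ‖ ≤ m :=
    fun σ hσ => hY.norm_le hc hlam hlc hDF hDFT hDF0 hDFT0 hs hσ
  have hZM : ∀ σ ∈ Icc s T, ‖Z σ‖ ≤ M := fun σ hσ =>
    norm_adjZ_le hc hDF hDFT hDF0 hDFT0 hs.1 hYm hσ
  have hsub : Icc s t ⊆ Icc s T := Icc_subset_Icc_right ht.2
  have hsT : s ∈ Icc s T := left_mem_Icc.2 hs.2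
  have htT : t ∈ Icc s T := ⟨hst, ht.2⟩
  have hYs : Y s = X := hY.apply_left hs.2
  have hZlip : ∀ σ ∈ Icc s t, ‖Z σ - Z s‖ ≤ M * (t - s) := by
    intro σ hσ
    rw [norm_sub_rev, hZ, adjZ_sub_adjZ hDFc hY.1]
    refine (intervalIntegral.norm_integral_le_of_norm_le_const (C := M) fun r hr => ?_).trans ?_
    · rw [uIoc_of_le hσ.1] at hr
      exact hDFM (hYm r ⟨hr.1.le, hr.2.trans (hσ.2.trans ht.2)⟩)
    · rw [abs_of_nonneg (sub_nonneg.2 hσ.1)]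
      gcongr
      exact hσ.2
  have hYlip : ∀ σ ∈ Icc s t, ‖Y σ - X‖ ≤ P * (t - s) := by
    intro σ hσ
    rw [norm_sub_rev, ← hYs, hY.sub_apply hDFc hsT (hsub hσ), norm_smul,
      Real.norm_of_nonneg (by positivity)]
    have : ‖∫ r in s..σ, Z r‖ ≤ M * |σ - s| := by
      refine intervalIntegral.norm_integral_le_of_norm_le_const fun r hr => ?_
      rw [uIoc_of_le hσ.1] at hr
      exact hZM r ⟨hr.1.le, hr.2.trans (hσ.2.trans ht.2)⟩
    rw [abs_of_nonneg (sub_nonneg.2 hσ.1)] at this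
    calc 1 / lam * ‖∫ r in s..σ, Z r‖ ≤ 1 / lam * (M * (t - s)) := by
          gcongr
          exact this.trans (by gcongr; exact hσ.2)
      _ = P * (t - s) := by rw [hP]; ring
  have hFlip : ∀ σ ∈ Icc s t, |F (Y σ) - F X| ≤ (M * P + c / 2 * P ^ 2 * T) * (t - s) := by
    intro σ hσ
    have h1 := abs_sub_sub_inner_le_of_lipschitz_gradient hF hDF X (Y σ)
    have h2 : |⟪DF X, Y σ - X⟫| ≤ M * (P * (t - s)) := by
      refine (abs_real_inner_le_norm _ _).trans ?_
      gcongr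
      · exact hDFM (hYs ▸ hYm s hsT)
      · exact hYlip σ hσ
    have h3 : c / 2 * ‖Y σ - X‖ ^ 2 ≤ c / 2 * P ^ 2 * T * (t - s) := by
      calc c / 2 * ‖Y σ - X‖ ^ 2 ≤ c / 2 * (P * (t - s)) ^ 2 := by gcongr; exact hYlip σ hσ
        _ = c / 2 * P ^ 2 * (t - s) * (t - s) := by ring
        _ ≤ _ := by gcongr
    have h4 := abs_add_le (F (Y σ) - F X - ⟪DF X, Y σ - X⟫) ⟪DF X, Y σ - X⟫
    rw [sub_add_cancel] at h4
    linarith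
  have hGs : G X s = Z s := hG s hs X Y hY
  have hYt := hY.restrict hDFc htT
  have hGt : G (Y t) t = Z t := hG t ht (Y t) Y hYt
  have htt : t ∈ Icc s t := right_mem_Icc.2 hst
  have hGlip : ‖G X t - G X s‖ ≤ L₁ * (t - s) := by
    have h1 : ‖G X t - G (Y t) t‖ ≤ 6 * K * (P * (t - s)) := by
      refine (lipschitz_of_abs_sub_sub_inner_le hK (hVG t ht) (Y t) X).trans ?_
      rw [norm_sub_rev]
      gcongr
      exact hYlip t htt
    have h2 := norm_add_le (G X t - G (Y t) t) (Z t - Z s)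
    rw [hGs]
    rw [hGt, sub_add_sub_cancel] at h2
    rw [hGt] at h1
    calc _ ≤ _ := h2
      _ ≤ 6 * K * (P * (t - s)) + M * (t - s) := add_le_add h1 (hZlip t htt)
      _ = _ := by rw [hL₁]; ring
  refine ⟨?_, ?_, ?_⟩
  · set ℓ : ℝ → ℝ := fun σ => 1 / (2 * lam) * ‖Z σ‖ ^ 2 + F (Y σ) with hℓ
    have hi1 : ∀ a b, IntervalIntegrable (fun σ => ‖Z σ‖ ^ 2) volume a b :=
      fun a b => (hZc.norm.pow 2).intervalIntegrable a b
    have hi2 : ∀ a b, IntervalIntegrable (fun σ => F (Y σ)) volume a b :=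
      fun a b => (hFc.comp hY.1).intervalIntegrable a b
    have hℓc : Continuous ℓ := ((hZc.norm.pow 2).const_mul _).add (hFc.comp hY.1)
    have hdyn : V (Y t) t - V X s = -∫ σ in s..t, ℓ σ := by
      rw [hV t ht (Y t) Y hYt, hV s hs X Y hY,
        ← intervalIntegral.integral_add_adjacent_intervals (hi1 s t) (hi1 t T),
        ← intervalIntegral.integral_add_adjacent_intervals (hi2 s t) (hi2 t T),
        intervalIntegral.integral_add ((hi1 s t).const_mul _) (hi2 s t),
        intervalIntegral.integral_const_mul]
      ring
    have b1 : |(∫ σ in s..t, ℓ σ) - (t - s) * ℓ s| ≤ A * (t - s) ^ 2 := by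
      refine norm_integral_sub_smul_le hℓc hst fun σ hσ => ?_
      have h1 := abs_sq_norm_sub_sq_norm_le (hZM σ (hsub hσ)) (hZM s hsT) (hZlip σ hσ)
      have h2 : ℓ σ - ℓ s = 1 / (2 * lam) * (‖Z σ‖ ^ 2 - ‖Z s‖ ^ 2) + (F (Y σ) - F X) := by
        rw [← hYs]; ring
      rw [h2]
      refine (norm_add_le _ _).trans ?_
      rw [norm_mul, Real.norm_of_nonneg (by positivity : 0 ≤ 1 / (2 * lam))]
      calc _ ≤ 1 / (2 * lam) * (2 * M * (M * (t - s)))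
            + (M * P + c / 2 * P ^ 2 * T) * (t - s) := by gcongr; exacts [h1, hFlip σ hσ]
        _ = _ := by rw [hA]; ring
    have b2 : |⟪Z t, X - Y t⟫ - (t - s) * (1 / lam * ‖Z s‖ ^ 2)| ≤ 2 * (M * P) * (t - s) ^ 2 := by
      have h1 := norm_integral_sub_smul_le hZc hst hZlip
      have h2 : X - Y t = (1 / lam) • ∫ σ in s..t, Z σ := by
        rw [← hYs]; exact hY.sub_apply hDFc hsT htT
      have h3 : ⟪Z t, X - Y t⟫ - (t - s) * (1 / lam * ‖Z s‖ ^ 2)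
          = 1 / lam * ⟪Z t, (∫ σ in s..t, Z σ) - (t - s) • Z s⟫
            + 1 / lam * (t - s) * ⟪Z t - Z s, Z s⟫ := by
        rw [h2, inner_sub_right, inner_sub_left, inner_smul_right, inner_smul_right,
          real_inner_self_eq_norm_sq]
        ring
      rw [h3]
      refine (abs_add_le _ _).trans ?_
      rw [abs_mul, abs_mul, abs_of_nonneg (by positivity : 0 ≤ 1 / lam),
        abs_of_nonneg (by positivity : 0 ≤ 1 / lam * (t - s))]
      have h4 : |⟪Z t, (∫ σ in s..t, Z σ) - (t - s) • Z s⟫| ≤ M * (M * (t - s) ^ 2) :=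
        (abs_real_inner_le_norm _ _).trans (by gcongr; exact hZM t htT)
      have h5 : |⟪Z t - Z s, Z s⟫| ≤ M * (t - s) * M :=
        (abs_real_inner_le_norm _ _).trans (by gcongr; exacts [hZlip t htt, hZM s hsT])
      calc _ ≤ 1 / lam * (M * (M * (t - s) ^ 2)) + 1 / lam * (t - s) * (M * (t - s) * M) := by
            gcongr
        _ = _ := by rw [hP]; ring
    have b3 : |V X t - V (Y t) t - ⟪Z t, X - Y t⟫| ≤ K * P ^ 2 * (t - s) ^ 2 := by
      rw [← hGt]
      refine (hVG t ht (Y t) X).trans ?_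
      rw [norm_sub_rev]
      calc K * ‖Y t - X‖ ^ 2 ≤ K * (P * (t - s)) ^ 2 := by gcongr; exact hYlip t htt
        _ = _ := by ring
    have hsum : V X t - V X s - (t - s) * (1 / (2 * lam) * ‖G X s‖ ^ 2 - F X)
        = (V X t - V (Y t) t - ⟪Z t, X - Y t⟫)
          + (⟪Z t, X - Y t⟫ - (t - s) * (1 / lam * ‖Z s‖ ^ 2))
          - ((∫ σ in s..t, ℓ σ) - (t - s) * ℓ s) := by
      have : V X s = V (Y t) t + ∫ σ in s..t, ℓ σ := by linarith
      have hℓs : ℓ s = 1 / (2 * lam) * ‖Z s‖ ^ 2 + F X := by rw [← hYs]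
      rw [this, hGs, hℓs]
      field_simp
      ring
    rw [hsum]
    have h6 := abs_sub (V X t - V (Y t) t - ⟪Z t, X - Y t⟫
      + (⟪Z t, X - Y t⟫ - (t - s) * (1 / lam * ‖Z s‖ ^ 2)))
      ((∫ σ in s..t, ℓ σ) - (t - s) * ℓ s)
    have h7 := abs_add_le (V X t - V (Y t) t - ⟪Z t, X - Y t⟫)
      (⟪Z t, X - Y t⟫ - (t - s) * (1 / lam * ‖Z s‖ ^ 2))
    have h8 : L₂ * (t - s) ^ 2 ≤ (L₁ + L₂ + L₃) * (t - s) ^ 2 := by gcongr; linarith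
    rw [hL₂] at h8
    linarith
  · rw [sub_sub_sub_cancel_right, ← mul_sub, abs_mul,
      abs_of_nonneg (by positivity : 0 ≤ 1 / (2 * lam))]
    calc _ ≤ 1 / (2 * lam) * (2 * M * (L₁ * (t - s))) := by
          gcongr
          exact abs_sq_norm_sub_sq_norm_le (hGM t ht) (hGM s hs) hGlip
      _ = L₃ * (t - s) := by rw [hL₃]; ring
      _ ≤ _ := by gcongr; linarith
  · exact hGlip.trans (by gcongr; linarith)

end TimeRegularity

/-- the value function is `C¹` on `H × [0,T]` (it admits continuous partial
derivatives: a gradient `G` in `X` and a time derivative `Vt`) and satisfies the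
Hamilton-Jacobi-Bellman equation with terminal condition `V(X,T) = F_T(X)`. -/
theorem statement13
    (F FT : H → ℝ) (DF DFT : H → H) (c T lam : ℝ)
    (hF : ∀ X, HasGradientAt F (DF X) X) (hFT : ∀ X, HasGradientAt FT (DFT X) X)
    (hDF : ∀ X₁ X₂ : H, ‖DF X₁ - DF X₂‖ ≤ c * ‖X₁ - X₂‖)
    (hDFT : ∀ X₁ X₂ : H, ‖DFT X₁ - DFT X₂‖ ≤ c * ‖X₁ - X₂‖)
    (hDF0 : ‖DF 0‖ ≤ c) (hDFT0 : ‖DFT 0‖ ≤ c)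
    (hT : 0 < T) (hlam : 0 < lam)
    (hlc : c * T * (1 + T) < lam) :
    ∃ G : H → ℝ → H, ∃ Vt : H → ℝ → ℝ,
      ContinuousOn (fun p : H × ℝ => G p.1 p.2) ((univ : Set H) ×ˢ Icc (0 : ℝ) T) ∧
      ContinuousOn (fun p : H × ℝ => Vt p.1 p.2) ((univ : Set H) ×ˢ Icc (0 : ℝ) T) ∧
      (∀ X : H, ∀ t ∈ Icc 0 T,
        HasGradientAt (fun X' => valueFn F FT lam T X' t) (G X t) X) ∧
      (∀ X : H, ∀ t ∈ Icc 0 T,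
        HasDerivWithinAt (fun τ => valueFn F FT lam T X τ) (Vt X t) (Icc 0 T) t) ∧
      (∀ X : H, ∀ t ∈ Ico 0 T,
        Vt X t - 1 / (2 * lam) * ‖G X t‖ ^ 2 + F X = 0) ∧
      (∀ X : H, valueFn F FT lam T X T = FT X) := by
  have hc : 0 ≤ c := (norm_nonneg _).trans hDF0
  have hFc : Continuous F := continuous_iff_continuousAt.2 fun x => (hF x).continuousAt
  obtain ⟨K, hK, hexp⟩ := exists_abs_valueFn_sub_le hc hlam hT.le hlc hF hFT hDF hDFT
  set V := valueFn F FT lam T with hV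
  set G : H → ℝ → H := fun X t => gradient (fun X' => V X' t) X with hGdef
  have hG : ∀ t ∈ Icc 0 T, ∀ X Y, IsExtremal DF DFT lam T X t Y →
      G X t = adjZ DF DFT T Y t := fun t ht X Y hY =>
    (hasGradientAt_of_abs_sub_sub_inner_le (hexp t ht X Y hY).2).gradient
  have hVG : ∀ t ∈ Icc 0 T, ∀ X X', |V X' t - V X t - ⟪G X t, X' - X⟫| ≤ K * ‖X' - X‖ ^ 2 := by
    intro t ht X
    obtain ⟨Y, hY⟩ := exists_isExtremal hc hlam hlc hDF hDFT ht X
    rw [hG t ht X Y hY]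
    exact (hexp t ht X Y hY).2
  have htime := exists_time_expansion (V := V) (FT := FT) hc hlam hT.le hlc hF hDF hDFT hDF0 hDFT0
    hK (fun t ht X Y hY => (hexp t ht X Y hY).1.trans (hY.cost_eq ht.2 hlam)) hG hVG
  have hGc : ContinuousOn (fun p : H × ℝ => G p.1 p.2) ((univ : Set H) ×ˢ Icc (0 : ℝ) T) := by
    refine continuousOn_prod_of_continuousOn_lipschitzOnWith _ (6 * K).toNNReal (fun X _ => ?_)
      fun t ht => ?_
    · obtain ⟨L, hL⟩ := htime X
      refine (LipschitzOnWith.of_dist_le' (K := L) fun s hs t ht => ?_).continuousOn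
      rcases le_total s t with hst | hst
      · rw [dist_comm, dist_eq_norm, dist_comm, Real.dist_eq, abs_of_nonneg (sub_nonneg.2 hst)]
        exact (hL s hs t ht hst).2.2
      · rw [dist_eq_norm, Real.dist_eq, abs_of_nonneg (sub_nonneg.2 hst)]
        exact (hL t ht s hs hst).2.2
    · refine LipschitzOnWith.of_dist_le' fun X _ X' _ => ?_
      rw [dist_eq_norm, dist_eq_norm]
      exact lipschitz_of_abs_sub_sub_inner_le hK (hVG t ht) X' X
  refine ⟨G, fun X t => 1 / (2 * lam) * ‖G X t‖ ^ 2 - F X, hGc, ?_, ?_, ?_, ?_, ?_⟩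
  · exact ((hGc.norm.pow 2).const_mul _).sub (hFc.comp continuous_fst).continuousOn
  · exact fun X t ht => hasGradientAt_of_abs_sub_sub_inner_le (hVG t ht X)
  · intro X t ht
    obtain ⟨L, hL⟩ := htime X
    exact hasDerivWithinAt_of_abs_sub_le (f := fun τ => V X τ)
      (h := fun t => 1 / (2 * lam) * ‖G X t‖ ^ 2 - F X)
      (fun s hs t ht hst => (hL s hs t ht hst).1) (fun s hs t ht hst => (hL s hs t ht hst).2.1) ht
  · intro X t _
    ring
  · intro X
    have hTm : T ∈ Icc 0 T := right_mem_Icc.2 hT.le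
    obtain ⟨Y, hY⟩ := exists_isExtremal hc hlam hlc hDF hDFT hTm X
    rw [(hexp T hTm X Y hY).1, hY.cost_eq le_rfl hlam, hY.apply_left le_rfl]
    simp
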